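/- Let O be a DL-Lite ontology and let Σ_C, Σ_R be a finite signature. Then the unsatisfiable concept ⊥ admits a finite characterisation w.r.t. L(∃,⊓,⊤,⊥)[Σ_C,Σ_R] under O; moreover one can take E⁺ = ∅, i.e., there is a finite set E⁻ of finite pointed interpretations satisfying O such that every concept D ∈ L(∃,⊓,⊤,⊥)[Σ_C,Σ_R] with d ∉ D^I for all (I,d) ∈ E⁻ is unsatisfiable w.r.t. O. -/

import Mathlib

namespace DL

/-! ### Syntax of ALCQI concepts -/

/-- Roles: role names (indexed by ℕ) and inverse roles. -/
inductive Role where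
  | name : ℕ → Role
  | inv  : ℕ → Role
deriving DecidableEq

/-- ALCQI concept expressions. -/
inductive Concept where
  | atom : ℕ → Concept
  | top  : Concept
  | bot  : Concept
  | and  : Concept → Concept → Concept
  | or   : Concept → Concept → Concept
  | neg  : Concept → Concept
  | ex   : Role → Concept → Concept
  | all  : Role → Concept → Concept
  | atLeast : ℕ → Role → Concept → Concept
deriving DecidableEq

/-- The operators/constructors that a concept language may use. -/
inductive Op where
  | all | ex | ge | inv | and | or | top | bot | neg
deriving DecidableEq

/-! ### Interpretations and semantics -/

/-- An interpretation: a nonempty domain, interpretations of concept names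
and of role names. -/
structure Interp where
  Δ : Type
  dom_nonempty : Nonempty Δ
  atom : ℕ → Set Δ
  rel : ℕ → Δ → Δ → Prop

def Role.sem (I : Interp) : Role → (I.Δ → I.Δ → Prop)
  | .name R => I.rel R
  | .inv R  => fun d e => I.rel R e d

def Concept.sem (I : Interp) : Concept → Set I.Δ
  | .atom A => I.atom A
  | .top => Set.univ
  | .bot => ∅
  | .and C D => C.sem I ∩ D.sem I
  | .or C D => C.sem I ∪ D.sem I
  | .neg C => (C.sem I)ᶜ
  | .ex S C => {d | ∃ e, S.sem I d e ∧ e ∈ C.sem I}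
  | .all S C => {d | ∀ e, S.sem I d e → e ∈ C.sem I}
  | .atLeast k S C => {d | ∃ s : Finset I.Δ, s.card = k ∧ ∀ e ∈ s, S.sem I d e ∧ e ∈ C.sem I}

/-! ### Concept languages L(Os)[SC, SR] -/

def Role.inSig (Os : Finset Op) (SR : Finset ℕ) : Role → Prop
  | .name R => R ∈ SR
  | .inv R  => Op.inv ∈ Os ∧ R ∈ SR

/-- Membership of a concept in the language `L(Os)[SC, SR]`. -/
def Concept.inLang (Os : Finset Op) (SC SR : Finset ℕ) : Concept → Prop
  | .atom A => A ∈ SC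
  | .top => Op.top ∈ Os
  | .bot => Op.bot ∈ Os
  | .and C D => Op.and ∈ Os ∧ C.inLang Os SC SR ∧ D.inLang Os SC SR
  | .or C D => Op.or ∈ Os ∧ C.inLang Os SC SR ∧ D.inLang Os SC SR
  | .neg C => Op.neg ∈ Os ∧ C.inLang Os SC SR
  | .ex S C => Op.ex ∈ Os ∧ S.inSig Os SR ∧ C.inLang Os SC SR
  | .all S C => Op.all ∈ Os ∧ S.inSig Os SR ∧ C.inLang Os SC SR
  | .atLeast k S C => Op.ge ∈ Os ∧ 1 ≤ k ∧ S.inSig Os SR ∧ C.inLang Os SC SR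

/-! ### DL-Lite ontologies -/

/-- Basic concepts: concept names, ∃R and ∃R⁻. -/
inductive Basic where
  | atom : ℕ → Basic
  | ex : Role → Basic
deriving DecidableEq

def Basic.sem (I : Interp) : Basic → Set I.Δ
  | .atom A => I.atom A
  | .ex S => {d | ∃ e, S.sem I d e}

/-- A DL-Lite concept inclusion `B ⊑ C` where `C` is a basic concept
(`negated = false`) or a negated basic concept (`negated = true`). -/
structure CI where
  lhs : Basic
  rhs : Basic
  negated : Bool
deriving DecidableEq

def CI.sat (I : Interp) (ci : CI) : Prop :=
  if ci.negated then ci.lhs.sem I ⊆ (ci.rhs.sem I)ᶜ else ci.lhs.sem I ⊆ ci.rhs.sem I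

/-- A DL-Lite ontology: a finite set (list) of concept inclusions. -/
abbrev Ontology := List CI

def Interp.satO (I : Interp) (Ont : Ontology) : Prop := ∀ ci ∈ Ont, ci.sat I

/-! ### Pointed interpretations, examples, characterisations -/

structure PInterp where
  I : Interp
  pt : I.Δ

/-- A pointed interpretation is finite if its domain is finite. -/
def PInterp.finite (P : PInterp) : Prop := Finite P.I.Δ

/-- `C` fits a collection `(Epos, Eneg)` of labelled examples. -/
def Fits (C : Concept) (Epos Eneg : List PInterp) : Prop :=
  (∀ e ∈ Epos, e.pt ∈ C.sem e.I) ∧ (∀ e ∈ Eneg, e.pt ∉ C.sem e.I)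

/-- Equivalence of concepts. -/
def CEquiv (C D : Concept) : Prop := ∀ I : Interp, C.sem I = D.sem I

/-- Equivalence of concepts relative to an ontology. -/
def CEquivO (Ont : Ontology) (C D : Concept) : Prop :=
  ∀ I : Interp, I.satO Ont → C.sem I = D.sem I

/-- `⊨ C ⊑ D`. -/
def Subsumes (C D : Concept) : Prop := ∀ I : Interp, C.sem I ⊆ D.sem I

/-- `Ont ⊨ C ⊑ D`. -/
def SubsumesO (Ont : Ontology) (C D : Concept) : Prop :=
  ∀ I : Interp, I.satO Ont → C.sem I ⊆ D.sem I

/-- `(Epos, Eneg)` is a finite characterisation of `C` w.r.t. the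
concept language (predicate) `L`: all examples are finite, `C` fits,
and every fitting concept of `L` is equivalent to `C`. -/
def FinChar (L : Concept → Prop) (C : Concept) (Epos Eneg : List PInterp) : Prop :=
  (∀ e ∈ Epos ++ Eneg, e.finite) ∧
  Fits C Epos Eneg ∧
  ∀ D, L D → Fits D Epos Eneg → CEquiv C D

/-- Finite characterisation of `C` w.r.t. `L` under an ontology `Ont`:
all examples are finite and satisfy `Ont`, `C` fits, and every fitting
concept of `L` is equivalent to `C` relative to `Ont`. -/
def FinCharO (Ont : Ontology) (L : Concept → Prop) (C : Concept)
    (Epos Eneg : List PInterp) : Prop :=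
  (∀ e ∈ Epos ++ Eneg, e.finite ∧ e.I.satO Ont) ∧
  Fits C Epos Eneg ∧
  ∀ D, L D → Fits D Epos Eneg → CEquivO Ont C D

/-- `L(Os)` admits finite characterisations. -/
def AdmitsFinChar (Os : Finset Op) : Prop :=
  ∀ SC SR : Finset ℕ, ∀ C : Concept, C.inLang Os SC SR →
    ∃ Epos Eneg : List PInterp, FinChar (Concept.inLang Os SC SR) C Epos Eneg

/-- `L(Os)` admits finite characterisations under the ontology `Ont`. -/
def AdmitsFinCharO (Os : Finset Op) (Ont : Ontology) : Prop :=
  ∀ SC SR : Finset ℕ, ∀ C : Concept, C.inLang Os SC SR →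
    ∃ Epos Eneg : List PInterp, FinCharO Ont (Concept.inLang Os SC SR) C Epos Eneg

/-! ### Size, role depth, number restrictions -/

/-- Number of symbols of a concept expression (numbers in binary). -/
def Concept.size : Concept → ℕ
  | .atom _ => 1
  | .top => 1
  | .bot => 1
  | .and C D => C.size + D.size + 1
  | .or C D => C.size + D.size + 1
  | .neg C => C.size + 1
  | .ex _ C => C.size + 2
  | .all _ C => C.size + 2
  | .atLeast k _ C => C.size + 2 + Nat.size k

/-- Role depth of a concept. -/
def Concept.dp : Concept → ℕ
  | .atom _ => 0
  | .top => 0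
  | .bot => 0
  | .and C D => max C.dp D.dp
  | .or C D => max C.dp D.dp
  | .neg C => C.dp
  | .ex _ C => C.dp + 1
  | .all _ C => C.dp + 1
  | .atLeast _ _ C => C.dp + 1

/-- The largest number occurring in a number restriction of `C` (0 if none). -/
def Concept.nr : Concept → ℕ
  | .atom _ => 0
  | .top => 0
  | .bot => 0
  | .and C D => max C.nr D.nr
  | .or C D => max C.nr D.nr
  | .neg C => C.nr
  | .ex _ C => C.nr
  | .all _ C => C.nr
  | .atLeast k _ C => max k C.nr

/-- The operator set of `L(∃,⊓,⊤,⊥)`. -/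
def ELbotOps : Finset Op := {Op.ex, Op.and, Op.top, Op.bot}

/-- The set of right-hand sides of inclusions of `Ont` that hold at `d`. -/
def Interp.rhsType (Ont : Ontology) (I : Interp) (d : I.Δ) : Set {ci // ci ∈ Ont} :=
  {ci | d ∈ ci.1.rhs.sem I}

/-- The filtration, through right-hand-side types, of the disjoint union of all models
of `Ont`. -/
def filtration (Ont : Ontology) : Interp where
  Δ := Set {ci // ci ∈ Ont}
  dom_nonempty := ⟨∅⟩
  atom A := {t | ∃ I : Interp, I.satO Ont ∧ ∃ d, I.rhsType Ont d = t ∧ d ∈ I.atom A}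
  rel R t u := ∃ I : Interp, I.satO Ont ∧
    ∃ d e, I.rhsType Ont d = t ∧ I.rhsType Ont e = u ∧ I.rel R d e

instance (Ont : Ontology) : Finite (filtration Ont).Δ :=
  inferInstanceAs (Finite (Set {ci // ci ∈ Ont}))

theorem mem_basic_sem_filtration {Ont : Ontology} {B : Basic} {t : (filtration Ont).Δ} :
    t ∈ B.sem (filtration Ont) ↔
      ∃ I : Interp, I.satO Ont ∧ ∃ d, I.rhsType Ont d = t ∧ d ∈ B.sem I := by
  match B with
  | .atom A => exact Iff.rfl
  | .ex (.name R) =>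
    constructor
    · rintro ⟨u, I, hI, d, e, hd, -, hR⟩
      exact ⟨I, hI, d, hd, e, hR⟩
    · rintro ⟨I, hI, d, hd, e, hR⟩
      exact ⟨I.rhsType Ont e, I, hI, d, e, hd, rfl, hR⟩
  | .ex (.inv R) =>
    constructor
    · rintro ⟨u, I, hI, e, d, -, hd, hR⟩
      exact ⟨I, hI, d, hd, e, hR⟩
    · rintro ⟨I, hI, d, hd, e, hR⟩
      exact ⟨I.rhsType Ont e, I, hI, e, d, rfl, hd, hR⟩

theorem filtration_satO (Ont : Ontology) : (filtration Ont).satO Ont := by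
  intro ci hci
  unfold CI.sat
  split_ifs with hneg
  · intro t hl hr
    obtain ⟨I, hI, d, hd, hdl⟩ := mem_basic_sem_filtration.1 hl
    obtain ⟨J, -, e, he, her⟩ := mem_basic_sem_filtration.1 hr
    have hsat := hI ci hci
    rw [CI.sat, if_pos hneg] at hsat
    have hmem : (⟨ci, hci⟩ : {ci // ci ∈ Ont}) ∈ J.rhsType Ont e := her
    rw [he.trans hd.symm] at hmem
    exact hsat hdl hmem
  · intro t hl
    obtain ⟨I, hI, d, hd, hdl⟩ := mem_basic_sem_filtration.1 hl
    have hsat := hI ci hci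
    rw [CI.sat, if_neg hneg] at hsat
    exact mem_basic_sem_filtration.2 ⟨I, hI, d, hd, hsat hdl⟩

theorem rhsType_mem_sem_filtration {SC SR : Finset ℕ} {Ont : Ontology} {I : Interp}
    (hI : I.satO Ont) {D : Concept} (hD : D.inLang ELbotOps SC SR) {d : I.Δ}
    (hd : d ∈ D.sem I) : I.rhsType Ont d ∈ D.sem (filtration Ont) := by
  induction D generalizing d with
  | atom A => exact ⟨I, hI, d, rfl, hd⟩
  | top => trivial
  | bot => exact hd.elim
  | and C D ihC ihD => exact ⟨ihC hD.2.1 hd.1, ihD hD.2.2 hd.2⟩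
  | ex S C ih =>
    obtain ⟨e, hS, he⟩ := hd
    refine ⟨I.rhsType Ont e, ?_, ih hD.2.2 he⟩
    cases S with
    | name R => exact ⟨I, hI, d, e, rfl, rfl, hS⟩
    | inv R => exact ⟨I, hI, e, d, rfl, rfl, hS⟩
  | or C D => exact absurd hD.1 (by decide)
  | neg C => exact absurd hD.1 (by decide)
  | all S C => exact absurd hD.1 (by decide)
  | atLeast k S C => exact absurd hD.1 (by decide)

/-- **Lemma**: for every DL-Lite ontology `Ont`, the unsatisfiable concept
`⊥` has a finite characterisation w.r.t. `L(∃,⊓,⊤,⊥)[SC,SR]` under `Ont`;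
moreover one can take the positive examples to be empty: there is a finite
set `Eneg` of finite pointed interpretations satisfying `Ont` such that
every `D ∈ L(∃,⊓,⊤,⊥)[SC,SR]` falsified on all of them is unsatisfiable
w.r.t. `Ont`. -/
theorem bot_characterisation_under_ontology (SC SR : Finset ℕ) (Ont : Ontology) :
    ∃ Eneg : List PInterp,
      FinCharO Ont (Concept.inLang ELbotOps SC SR) Concept.bot [] Eneg ∧
      (∀ e ∈ Eneg, e.finite ∧ e.I.satO Ont) ∧
      ∀ D : Concept, D.inLang ELbotOps SC SR →
        (∀ e ∈ Eneg, e.pt ∉ D.sem e.I) →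
        ∀ I : Interp, I.satO Ont → D.sem I = ∅ := by
  have := Fintype.ofFinite (filtration Ont).Δ
  let Eneg : List PInterp := (Finset.univ : Finset (filtration Ont).Δ).toList.map
    fun t => ⟨filtration Ont, t⟩
  have hex : ∀ e ∈ Eneg, e.finite ∧ e.I.satO Ont := by
    intro e he
    obtain ⟨t, -, rfl⟩ := List.mem_map.1 he
    exact ⟨inferInstanceAs (Finite (filtration Ont).Δ), filtration_satO Ont⟩
  have hunsat : ∀ D : Concept, D.inLang ELbotOps SC SR → (∀ e ∈ Eneg, e.pt ∉ D.sem e.I) →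
      ∀ I : Interp, I.satO Ont → D.sem I = ∅ := by
    intro D hD hfit I hI
    refine Set.eq_empty_iff_forall_notMem.2 fun d hd => ?_
    refine hfit ⟨filtration Ont, I.rhsType Ont d⟩ ?_ (rhsType_mem_sem_filtration hI hD hd)
    exact List.mem_map.2 ⟨_, Finset.mem_toList.2 (Finset.mem_univ _), rfl⟩
  refine ⟨Eneg, ⟨by simpa using hex, ⟨by simp, fun e _ he => he⟩, ?_⟩, hex, hunsat⟩
  exact fun D hD hfit I hI => (hunsat D hD hfit.2 I hI).symm

end DL
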